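/- For all n, k ∈ ℕ one has 2·s_{k+1}(n) ≥ 2·s_k(n) + (1+α)^k, and consequently, for all k ∈ ℕ, the inequality (s_k(n) : ℚ) ≥ n + ((1+α)^k − 1)/(2α) holds. -/

import Mathlib

/-- The power of `α` whose exponent counts the odd terms among `x, C x, …, C^[k-1] x`. -/
def collatzSlope (α : ℕ) (C : ℕ → ℕ) : ℕ → ℕ → ℕ
  | 0, _ => 1
  | k + 1, x => (if C^[k] x % 2 = 0 then 1 else α) * collatzSlope α C k x

theorem collatzSlope_odd {α : ℕ} (hα : Odd α) (C : ℕ → ℕ) (k x : ℕ) :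
    Odd (collatzSlope α C k x) := by
  induction k with
  | zero => exact odd_one
  | succ k ih =>
    rw [collatzSlope]
    split_ifs
    · simpa using ih
    · exact hα.mul ih

theorem collatz_add_two_mul {α β : ℕ} {C : ℕ → ℕ}
    (hC : ∀ n : ℕ, C n = if n % 2 = 0 then n / 2 else (α * n + β) / 2) (y a : ℕ) :
    C (y + 2 * a) = C y + (if y % 2 = 0 then 1 else α) * a := by
  rw [hC, hC y, Nat.add_mul_mod_self_left]
  split_ifs
  · omega
  · rw [show α * (y + 2 * a) + β = α * y + β + 2 * (α * a) by ring,
      Nat.add_mul_div_left _ _ two_pos]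

/-- Shifting the argument by `2 ^ k` shifts the `k`-th iterate by the slope, and preserves the
slope. -/
theorem collatz_iterate_add_two_pow {α β : ℕ} {C : ℕ → ℕ}
    (hC : ∀ n : ℕ, C n = if n % 2 = 0 then n / 2 else (α * n + β) / 2) (k x : ℕ) :
    C^[k] (x + 2 ^ k) = C^[k] x + collatzSlope α C k x ∧
      collatzSlope α C k (x + 2 ^ k) = collatzSlope α C k x := by
  induction k generalizing x with
  | zero => simp [collatzSlope]
  | succ k ih =>
    have hx : C^[k] (x + 2 ^ (k + 1)) = C^[k] x + 2 * collatzSlope α C k x := by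
      rw [pow_succ, mul_two, ← add_assoc, (ih _).1, (ih _).1, (ih _).2]
      ring
    have hs : collatzSlope α C k (x + 2 ^ (k + 1)) = collatzSlope α C k x := by
      rw [pow_succ, mul_two, ← add_assoc, (ih _).2, (ih _).2]
    refine ⟨?_, ?_⟩
    · rw [Function.iterate_succ_apply', Function.iterate_succ_apply', hx,
        collatz_add_two_mul hC, collatzSlope]
    · rw [collatzSlope, collatzSlope, hx, hs, Nat.add_mul_mod_self_left]

theorem sum_range_two_pow_succ (f : ℕ → ℕ) (n k : ℕ) :
    ∑ j ∈ Finset.range (2 ^ (k + 1)), f (n + j)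
      = ∑ j ∈ Finset.range (2 ^ k), (f (n + j) + f (n + j + 2 ^ k)) := by
  rw [pow_succ, mul_two, Finset.sum_range_add, Finset.sum_add_distrib]
  congr 1
  refine Finset.sum_congr rfl fun j _ => ?_
  rw [add_assoc n j, add_comm j]

theorem sum_collatzSlope {α β : ℕ} (hα : Odd α) {C : ℕ → ℕ}
    (hC : ∀ n : ℕ, C n = if n % 2 = 0 then n / 2 else (α * n + β) / 2) (n k : ℕ) :
    ∑ j ∈ Finset.range (2 ^ k), collatzSlope α C k (n + j) = (1 + α) ^ k := by
  induction k with
  | zero => simp [collatzSlope]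
  | succ k ih =>
    rw [sum_range_two_pow_succ, pow_succ', ← ih, Finset.mul_sum]
    refine Finset.sum_congr rfl fun j _ => ?_
    obtain ⟨h1, h2⟩ := collatz_iterate_add_two_pow hC k (n + j)
    have ha := Nat.odd_iff.1 (collatzSlope_odd hα C k (n + j))
    rw [collatzSlope, collatzSlope, h1, h2]
    split_ifs
    · omega
    · ring
    · ring
    · omega

/-- Two terms of opposite parity: a lower bound for the sum of their images. -/
theorem two_mul_add_le_collatz_add {α β : ℕ} (hα : Odd α) (hβ : Odd β) {C : ℕ → ℕ}
    (hC : ∀ n : ℕ, C n = if n % 2 = 0 then n / 2 else (α * n + β) / 2) (y : ℕ) {a : ℕ}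
    (ha : Odd a) : 2 * y + a ≤ 2 * (C y + C (y + a)) := by
  have h2 (m : ℕ) (hm : m % 2 = 1) : m + β ≤ 2 * C m := by
    rw [hC, if_neg (by omega)]
    have h1 : (α * m + β) % 2 = 0 :=
      Nat.even_iff.1 ((hα.mul (Nat.odd_iff.2 hm)).add_odd hβ)
    have := Nat.le_mul_of_pos_left m hα.pos
    omega
  have h3 (m : ℕ) (hm : m % 2 = 0) : m ≤ 2 * C m := by
    rw [hC, if_pos hm]
    omega
  have ha' := Nat.odd_iff.1 ha
  rcases Nat.mod_two_eq_zero_or_one y with h | h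
  · have := h3 y h
    have := h2 (y + a) (by omega)
    omega
  · have := h2 y h
    have := h3 (y + a) (by omega)
    omega

theorem collatz_sum_succ_lower_bound {α β : ℕ} (hα : Odd α) (hβ : Odd β) {C : ℕ → ℕ}
    (hC : ∀ n : ℕ, C n = if n % 2 = 0 then n / 2 else (α * n + β) / 2) (n k : ℕ) :
    2 * ∑ j ∈ Finset.range (2 ^ k), C^[k] (n + j) + (1 + α) ^ k
      ≤ 2 * ∑ j ∈ Finset.range (2 ^ (k + 1)), C^[k + 1] (n + j) := by
  rw [sum_range_two_pow_succ (C^[k + 1]), ← sum_collatzSlope hα hC n k, Finset.mul_sum,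
    Finset.mul_sum, ← Finset.sum_add_distrib]
  refine Finset.sum_le_sum fun j _ => ?_
  rw [Function.iterate_succ_apply', Function.iterate_succ_apply',
    (collatz_iterate_add_two_pow hC k (n + j)).1]
  exact two_mul_add_le_collatz_add hα hβ hC _ (collatzSlope_odd hα C k _)


/-- 2·s_{k+1}(n) ≥ 2·s_k(n) + (1+α)^k, and consequently
(s_k(n) : ℚ) ≥ n + ((1+α)^k − 1)/(2α). -/
theorem collatz_sum_lower_bound
    (α β : ℕ) (hα : Odd α) (hα0 : 0 < α) (hβ : Odd β) (hβ0 : 0 < β)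
    (hgcd : Nat.gcd α β = 1) (C : ℕ → ℕ)
    (hC : ∀ n : ℕ, C n = if n % 2 = 0 then n / 2 else (α * n + β) / 2) :
    (∀ n k : ℕ,
      2 * ∑ j ∈ Finset.range (2 ^ (k + 1)), C^[k + 1] (n + j)
        ≥ 2 * ∑ j ∈ Finset.range (2 ^ k), C^[k] (n + j) + (1 + α) ^ k) ∧
    (∀ n k : ℕ,
      ((∑ j ∈ Finset.range (2 ^ k), C^[k] (n + j) : ℕ) : ℚ)
        ≥ (n : ℚ) + ((1 + (α : ℚ)) ^ k - 1) / (2 * (α : ℚ))) := by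
  refine ⟨collatz_sum_succ_lower_bound hα hβ hC, fun n k => ?_⟩
  have hα' : (0 : ℚ) < α := by exact_mod_cast hα0
  induction k with
  | zero => simp
  | succ k ih =>
    have h : (2 : ℚ) * ((∑ j ∈ Finset.range (2 ^ k), C^[k] (n + j) : ℕ) : ℚ) + (1 + (α : ℚ)) ^ k
        ≤ 2 * ((∑ j ∈ Finset.range (2 ^ (k + 1)), C^[k + 1] (n + j) : ℕ) : ℚ) := by
      exact_mod_cast collatz_sum_succ_lower_bound hα hβ hC n k
    have hstep : ((1 + (α : ℚ)) ^ (k + 1) - 1) / (2 * (α : ℚ))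
        = ((1 + (α : ℚ)) ^ k - 1) / (2 * (α : ℚ)) + (1 + (α : ℚ)) ^ k / 2 := by
      field_simp
      ring
    linarith
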